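/- Let L > 0, ε > 0, and let f : ℝ → ℝ be Lipschitz continuous, positive, and L-periodic, and let q ∈ ℝ \ {0} satisfy 1/|q| ∈ [min f, max f]. Then for every differentiable solution y : [0, ∞) → ℝ of y'(t) = f((y(t) − t)/ε)·|q|, the average speed (y(T) − y(0))/T converges to 1 as T → ∞. -/

import Mathlib

open Set Filter Topology

/-- A forward solution of an autonomous Lipschitz equation that reaches an equilibrium stays
there. -/
lemma eq_of_reaches_equilibrium {v z : ℝ → ℝ} {M : NNReal} (hv : LipschitzWith M v)
    (hz : ∀ t ∈ Ici (0 : ℝ), HasDerivWithinAt z (v (z t)) (Ici 0) t)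
    {c s t : ℝ} (hc : v c = 0) (hs : 0 ≤ s) (hst : s ≤ t) (hzs : z s = c) : z t = c := by
  have h := ODE_solution_unique (v := fun _ => v) (K := M) (f := z) (g := fun _ => c)
    (a := s) (b := t) (fun _ => hv)
    (fun r hr => (hz r (hs.trans hr.1)).continuousWithinAt.mono
      (fun x hx => hs.trans hx.1))
    (fun r hr => (hz r (hs.trans hr.1)).mono (Ici_subset_Ici.2 (hs.trans hr.1)))
    continuousOn_const
    (fun r _ => by simpa [hc] using hasDerivWithinAt_const r (Ici r) c)
    hzs
  exact h (right_mem_Icc.2 hst)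

/-- The interval between two equilibria of an autonomous Lipschitz equation is forward
invariant. -/
lemma mem_Icc_of_equilibria {v z : ℝ → ℝ} {M : NNReal} (hv : LipschitzWith M v)
    (hz : ∀ t ∈ Ici (0 : ℝ), HasDerivWithinAt z (v (z t)) (Ici 0) t)
    {a b t : ℝ} (ha : v a = 0) (hb : v b = 0) (h0 : z 0 ∈ Icc a b) (ht : 0 ≤ t) :
    z t ∈ Icc a b := by
  have hcont : ContinuousOn z (Icc 0 t) := fun r hr =>
    (hz r hr.1).continuousWithinAt.mono (fun x hx => hx.1)
  constructor
  · by_contra! h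
    obtain ⟨s, hs, hzs⟩ := intermediate_value_Icc' ht hcont ⟨h.le, h0.1⟩
    exact h.ne (eq_of_reaches_equilibrium hv hz ha hs.1 hs.2 hzs)
  · by_contra! h
    obtain ⟨s, hs, hzs⟩ := intermediate_value_Icc ht hcont ⟨h0.2, h.le⟩
    exact h.ne' (eq_of_reaches_equilibrium hv hz hb hs.1 hs.2 hzs)

/-- A continuous periodic function attains every value between its infimum and its supremum. -/
lemma Function.Periodic.exists_eq_of_mem_Icc {f : ℝ → ℝ} {L m : ℝ} (hper : Function.Periodic f L)
    (hL : L ≠ 0) (hf : Continuous f) (hm : m ∈ Icc (sInf (range f)) (sSup (range f))) :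
    ∃ x, f x = m := by
  have hK : IsCompact (range f) := hper.compact_of_continuous hL hf
  have hne : (range f).Nonempty := range_nonempty f
  exact (isPreconnected_range hf).ordConnected.out (hK.sInf_mem hne) (hK.sSup_mem hne) hm


/-- Pinning of the average speed: with `f` Lipschitz, positive, `L`-periodic
and `1/|q| ∈ [min f, max f]`, every global solution of
`y' = f((y - t)/ε)·|q|` on `[0,∞)` has average speed `(y T - y 0)/T → 1` as
`T → ∞`. -/
theorem stmt3 (L ε : ℝ) (hL : 0 < L) (hε : 0 < ε)
    (f : ℝ → ℝ) (K : NNReal) (hlip : LipschitzWith K f) (hpos : ∀ x, 0 < f x)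
    (hper : Function.Periodic f L) (q : ℝ) (hq : q ≠ 0)
    (hq' : 1 / |q| ∈ Set.Icc (sInf (Set.range f)) (sSup (Set.range f)))
    (y : ℝ → ℝ)
    (hy : ∀ t ∈ Set.Ici (0 : ℝ),
      HasDerivWithinAt y (f ((y t - t) / ε) * |q|) (Set.Ici 0) t) :
    Filter.Tendsto (fun T => (y T - y 0) / T) Filter.atTop (nhds 1) := by
  have hq0 : |q| ≠ 0 := abs_ne_zero.2 hq
  obtain ⟨x, hx⟩ := hper.exists_eq_of_mem_Icc hL.ne' hlip.continuous hq'
  set v : ℝ → ℝ := fun w => f (w / ε) * |q| - 1 with hv_def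
  set z : ℝ → ℝ := fun t => y t - t with hz_def
  obtain ⟨M, hM⟩ : ∃ M : NNReal, LipschitzWith M v := by
    refine ⟨K * ‖ε⁻¹‖₊ * ‖q‖₊, LipschitzWith.of_dist_le_mul fun a b => ?_⟩
    have h := hlip.dist_le_mul (a / ε) (b / ε)
    simp only [Real.dist_eq] at h ⊢
    have h1 : v a - v b = (f (a / ε) - f (b / ε)) * |q| := by simp only [hv_def]; ring
    have h2 : a / ε - b / ε = ε⁻¹ * (a - b) := by ring
    rw [h1, abs_mul, abs_abs]
    rw [h2, abs_mul] at h
    calc |f (a / ε) - f (b / ε)| * |q| ≤ K * (|ε⁻¹| * |a - b|) * |q| := by gcongr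
      _ = _ := by push_cast; simp only [Real.norm_eq_abs]; ring
  have hz : ∀ t ∈ Ici (0 : ℝ), HasDerivWithinAt z (v (z t)) (Ici 0) t := fun t ht =>
    (hy t ht).sub (hasDerivWithinAt_id t _)
  have heq : ∀ n : ℤ, v (ε * (x + n * L)) = 0 := fun n => by
    simp only [hv_def]
    rw [mul_div_cancel_left₀ _ hε.ne', (hper.int_mul n) x, hx, one_div_mul_cancel hq0, sub_self]
  obtain ⟨n, hn⟩ : ∃ n : ℤ, z 0 ∈ Icc (ε * (x + n * L)) (ε * (x + (n + 1 : ℤ) * L)) := by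
    refine ⟨⌊(z 0 / ε - x) / L⌋, ?_, ?_⟩
    · have h := (le_div_iff₀ hL).1 (Int.floor_le ((z 0 / ε - x) / L))
      rw [mul_comm, ← le_div_iff₀ hε]
      linarith
    · have h := (div_lt_iff₀ hL).1 (Int.lt_floor_add_one ((z 0 / ε - x) / L))
      rw [mul_comm ε, ← div_le_iff₀ hε]
      push_cast
      linarith
  have hbound : ∀ T, 0 ≤ T → |z T - z 0| ≤ ε * L := fun T hT => by
    have h := mem_Icc_of_equilibria hM hz (heq n) (heq (n + 1)) hn hT
    have hw := abs_sub_le_of_le_of_le h.1 h.2 hn.1 hn.2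
    refine hw.trans_eq ?_
    push_cast
    ring
  have hlim : Tendsto (fun T => (z T - z 0) / T) atTop (𝓝 0) := by
    refine squeeze_zero_norm' ?_ (tendsto_const_nhds (x := ε * L).div_atTop tendsto_id)
    filter_upwards [eventually_gt_atTop 0] with T hT
    rw [Real.norm_eq_abs, abs_div, abs_of_pos hT]
    exact div_le_div_of_nonneg_right (hbound T hT.le) hT.le
  have h1 := hlim.const_add 1
  rw [add_zero] at h1
  refine h1.congr' ?_
  filter_upwards [eventually_gt_atTop 0] with T hT
  simp only [hz_def]
  field_simp
  ring
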